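/- A prime tournament G with |V(G)| ≥ 3 has no subtournament isomorphic to D_4 if and only if G is isomorphic to T_n for some odd n ≥ 3. -/

import Mathlib

/-- A tournament on a vertex type `V`: for any two distinct vertices exactly one of the
two possible directed edges is present. -/
structure Tournament (V : Type) where
  rel : V → V → Prop
  asymm : ∀ u v, rel u v → ¬ rel v u
  total : ∀ u v, u ≠ v → rel u v ∨ rel v u

namespace Tournament

variable {V : Type}

/-- `X` is a homogeneous set of the subtournament of `T` induced on `S`. -/
def HomogOn (T : Tournament V) (S X : Set V) : Prop :=
  X ⊆ S ∧ ∀ v ∈ S \ X, (∀ x ∈ X, T.rel v x) ∨ (∀ x ∈ X, T.rel x v)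

/-- The subtournament of `T` induced on `S` is prime: it is a (nonempty) tournament all
of whose homogeneous sets are trivial. -/
def PrimeOn (T : Tournament V) (S : Set V) : Prop :=
  S.Nonempty ∧ ∀ X : Set V, T.HomogOn S X → X.ncard ≤ 1 ∨ X = S

/-- The subtournament of `T` induced on `S` is isomorphic to the tournament on `Fin n`
with edge relation `r`. -/
def IsoOnFin (T : Tournament V) (S : Set V) {n : ℕ} (r : Fin n → Fin n → Prop) : Prop :=
  ∃ f : Fin n → V, Function.Injective f ∧ Set.range f = S ∧
    ∀ i j : Fin n, r i j ↔ T.rel (f i) (f j)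

/-- `T` has a subtournament isomorphic to the tournament on `Fin n` with edge relation `r`. -/
def HasSub (T : Tournament V) {n : ℕ} (r : Fin n → Fin n → Prop) : Prop :=
  ∃ f : Fin n → V, Function.Injective f ∧ ∀ i j : Fin n, r i j ↔ T.rel (f i) (f j)

/-- The subtournament of `T` induced on `S` has a subtournament isomorphic to the
tournament on `Fin n` with edge relation `r`. -/
def HasSubIn (T : Tournament V) (S : Set V) {n : ℕ} (r : Fin n → Fin n → Prop) : Prop :=
  ∃ f : Fin n → V, Function.Injective f ∧ (∀ i, f i ∈ S) ∧
    ∀ i j : Fin n, r i j ↔ T.rel (f i) (f j)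

/-- `v ∈ Ext(H)`: `v` is outside `H` and `H + v` is prime. -/
def mem_Ext (T : Tournament V) (H : Set V) (v : V) : Prop :=
  v ∉ H ∧ T.PrimeOn (insert v H)

/-- `v ∈ Z(H)`: `v` is outside `H` and `H` is a homogeneous set of `H + v`. -/
def mem_Z (T : Tournament V) (H : Set V) (v : V) : Prop :=
  v ∉ H ∧ T.HomogOn (insert v H) H

/-- `v ∈ V_x(H)`: `v` is outside `H` and `{v, x}` is a homogeneous set of `H + v`. -/
def mem_Vx (T : Tournament V) (H : Set V) (x v : V) : Prop :=
  v ∉ H ∧ T.HomogOn (insert v H) {v, x}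

/-- `C` is (the vertex set of) a cyclic triangle of `T`. -/
def CycTri (T : Tournament V) (C : Set V) : Prop :=
  ∃ a b c : V, C = {a, b, c} ∧ T.rel a b ∧ T.rel b c ∧ T.rel c a

/-- The cyclic triangles `C` and `C'` are triangle-connected: there is a sequence of
cyclic triangles from `C` to `C'` in which consecutive triangles share exactly two
vertices. -/
def TriConn (T : Tournament V) (C C' : Set V) : Prop :=
  ∃ m : ℕ, ∃ f : Fin (m + 1) → Set V,
    f 0 = C ∧ f (Fin.last m) = C' ∧ (∀ i, T.CycTri (f i)) ∧
    ∀ i : Fin m, ((f i.castSucc) ∩ (f i.succ)).ncard = 2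

/-- `T` is strongly connected. -/
def StronglyConnected (T : Tournament V) : Prop :=
  ∀ u v : V, Relation.ReflTransGen T.rel u v

/-- The subtournament of `T` induced on `S` is a transitive tournament. -/
def TransOn (T : Tournament V) (S : Set V) : Prop :=
  ∃ m : ℕ, ∃ f : Fin m → V, Function.Injective f ∧ Set.range f = S ∧
    ∀ i j : Fin m, i < j → T.rel (f i) (f j)

end Tournament

/-- The tournament `T_n` (`n = 2k+1` odd) on `Fin n`: `i → j` iff `j - i mod n ∈ {1, …, k}`. -/
def TTrel (n : ℕ) (i j : Fin n) : Prop :=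
  1 ≤ (j.val + n - i.val) % n ∧ (j.val + n - i.val) % n ≤ n / 2

/-- The tournament `U_n`: obtained from `T_n` by reversing all edges with both ends among
the first `k` vertices. -/
def UUrel (n : ℕ) (i j : Fin n) : Prop :=
  if i.val < n / 2 ∧ j.val < n / 2 then TTrel n j i else TTrel n i j

/-- The tournament `W_n` on `Fin n` (vertex `n-1` plays the role of `w_n`). -/
def WWrel (n : ℕ) (i j : Fin n) : Prop :=
  (i.val < j.val ∧ j.val < n - 1) ∨ (j.val = n - 1 ∧ i.val < n - 1 ∧ i.val % 2 = 1) ∨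
    (i.val = n - 1 ∧ j.val < n - 1 ∧ j.val % 2 = 0)

/-- The tournament `P_n` on `Fin n`: `i → j` iff `j - i ≥ 2` or `i = j + 1`. -/
def PPrel (n : ℕ) (i j : Fin n) : Prop := i.val + 2 ≤ j.val ∨ i.val = j.val + 1

/-- The tournament `D_4`: vertex `0` beats the cyclic triangle `{1, 2, 3}`. -/
def DDrel (i j : Fin 4) : Prop :=
  (i = 0 ∧ j ≠ 0) ∨ (i = 1 ∧ j = 2) ∨ (i = 2 ∧ j = 3) ∨ (i = 3 ∧ j = 1)

/-- The tournament `J_n` on `Fin n`: the identity ordering has exactly one backedge,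
from the last vertex to the first. -/
def JJrel (n : ℕ) (i j : Fin n) : Prop :=
  (i.val < j.val ∧ ¬(i.val = 0 ∧ j.val = n - 1)) ∨ (i.val = n - 1 ∧ j.val = 0)

/-- The tournament `K_n` on `Fin n`: the identity ordering has exactly one backedge,
from the last vertex to the second. -/
def KKrel (n : ℕ) (i j : Fin n) : Prop :=
  (i.val < j.val ∧ ¬(i.val = 1 ∧ j.val = n - 1)) ∨ (i.val = n - 1 ∧ j.val = 1)

/-- The tournament `K_n^*` on `Fin n`: the identity ordering has exactly one backedge,
from the second-to-last vertex to the first. -/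
def KKsrel (n : ℕ) (i j : Fin n) : Prop :=
  (i.val < j.val ∧ ¬(i.val = 0 ∧ j.val = n - 2)) ∨ (i.val = n - 2 ∧ j.val = 0)

/-- `(j, i)` (0-indexed, `i < j`) is one of the backedges of the defining ordering of `Q_n`. -/
def Qback (n i j : ℕ) : Prop :=
  (j = n - 2 ∧ i = 0) ∨ (j = n - 1 ∧ i = n - 3) ∨ (j = i + 1 ∧ j ≤ n - 3)

/-- The tournament `Q_n` on `Fin n`. -/
def QQrel (n : ℕ) (i j : Fin n) : Prop :=
  (i.val < j.val ∧ ¬ Qback n i.val j.val) ∨ (j.val < i.val ∧ Qback n j.val i.val)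

/-- `e` is a matching ordering of the tournament with edge relation `r` on `V`:
`e` lists all vertices and every vertex is the head or tail of at most one backedge. -/
def MatchingOrd {V : Type} (r : V → V → Prop) {m : ℕ} (e : Fin m → V) : Prop :=
  Function.Bijective e ∧
    ∀ i : Fin m, {j : Fin m | (i < j ∧ r (e j) (e i)) ∨ (j < i ∧ r (e i) (e j))}.Subsingleton

/-- `e` is a matching ordering of the subtournament induced on `S`. -/
def MatchingOrdOn {V : Type} (r : V → V → Prop) (S : Set V) {m : ℕ} (e : Fin m → V) : Prop :=
  Set.BijOn e Set.univ S ∧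
    ∀ i : Fin m, {j : Fin m | (i < j ∧ r (e j) (e i)) ∨ (j < i ∧ r (e i) (e j))}.Subsingleton

/-- The subtournament induced on `S` is a matching tournament. -/
def IsMatchingOn {V : Type} (r : V → V → Prop) (S : Set V) : Prop :=
  ∃ m : ℕ, ∃ e : Fin m → V, MatchingOrdOn r S e

/-- The permutation `σ_X` of the interval of integers `X = {b, …, a}` (identity off `X`):
the cycle `(b b+2 … a-2 a a-1 a-3 … b+1)` when `|X|` is odd and
`(b b+2 … a-1 a a-2 … b+1)` when `|X|` is even. -/
def sigmaX (b a x : ℕ) : ℕ :=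
  if x < b ∨ a < x then x
  else if a = b then x
  else if (x - b) % 2 = 0 then
    (if x + 2 ≤ a then x + 2 else if x + 1 ≤ a then x + 1 else x - 1)
  else (if b + 3 ≤ x then x - 2 else b)

/-- The permutation `τ_X = (b b+2)(b+1 b+3)` of `X = {b, b+1, b+2, b+3}`. -/
def tauX (b x : ℕ) : ℕ :=
  if x = b then b + 2 else if x = b + 2 then b
  else if x = b + 1 then b + 3 else if x = b + 3 then b + 1 else x

/-- The permutation `π_1` of the interval `{b, …, a}`: product of the transpositions
swapping the 1st and 2nd, 3rd and 4th, … elements of the interval. -/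
def pi1N (b a x : ℕ) : ℕ :=
  if x < b ∨ a < x then x
  else if (x - b) % 2 = 0 then (if x + 1 ≤ a then x + 1 else x)
  else x - 1

/-- The permutation `π_2` of the interval `{b, …, a}`: product of the transpositions
swapping the 2nd and 3rd, 4th and 5th, … elements of the interval. -/
def pi2N (b a x : ℕ) : ℕ :=
  if x < b ∨ a < x then x
  else if x = b then x
  else if (x - b) % 2 = 1 then (if x + 1 ≤ a then x + 1 else x)
  else x - 1

/-- The segment of the ordering `e` on positions `b, …, a` induces a transitive tournament,
with ordering given (relative to the standard ordering `f`) by the permutation `p`. -/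
def SegTrans {V : Type} (T : Tournament V) {n : ℕ} (e : Fin n → V) (b a : ℕ) (p : ℕ → ℕ) : Prop :=
  ∃ f : ℕ → V, (∀ x y : ℕ, b ≤ x → x < y → y ≤ a → T.rel (f x) (f y)) ∧
    ∀ i : Fin n, b ≤ i.val → i.val ≤ a → e i = f (p i.val)

/-- The segment of the ordering `e` on positions `b, …, a` induces a tournament isomorphic
to `P_m` (where `m = a - b + 1`), with ordering given (relative to the defining ordering
`f` of `P_m`) by the permutation `p`. -/
def SegP {V : Type} (T : Tournament V) {n : ℕ} (e : Fin n → V) (b a : ℕ) (p : ℕ → ℕ) : Prop :=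
  ∃ f : ℕ → V,
    (∀ x y : ℕ, b ≤ x → x ≤ a → b ≤ y → y ≤ a →
      (T.rel (f x) (f y) ↔ (x + 2 ≤ y ∨ x = y + 1))) ∧
    ∀ i : Fin n, b ≤ i.val → i.val ≤ a → e i = f (p i.val)

namespace Tournament

variable {V : Type}

lemma irrefl_self (T : Tournament V) (u : V) : ¬ T.rel u u := fun h => T.asymm u u h h

lemma ne_of_rel (T : Tournament V) {u v : V} (h : T.rel u v) : u ≠ v := by
  rintro rfl; exact T.irrefl_self _ h

lemma rel_of_not (T : Tournament V) {u v : V} (hne : u ≠ v) (h : ¬ T.rel u v) : T.rel v u :=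
  (T.total u v hne).resolve_left h

/-- Basic use of primality. -/
lemma prime_tool [Fintype V] (T : Tournament V) (hP : T.PrimeOn Set.univ) (X : Set V) {a b : V}
    (ha : a ∈ X) (hb : b ∈ X) (hab : a ≠ b)
    (h : ∀ v, v ∉ X → (∀ x ∈ X, T.rel v x) ∨ (∀ x ∈ X, T.rel x v)) : X = Set.univ := by
  rcases hP.2 X ⟨Set.subset_univ _, fun v hv => h v hv.2⟩ with h1 | h1
  · rw [Set.ncard_le_one (Set.toFinite _)] at h1
    exact absurd (h1 a ha b hb) hab
  · exact h1

lemma exists_third [Fintype V] (h3 : 3 ≤ Nat.card V) (a b : V) : ∃ c, c ≠ a ∧ c ≠ b := by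
  by_contra hcon
  push Not at hcon
  have : (Set.univ : Set V) = {a, b} := by
    ext x
    simp only [Set.mem_univ, Set.mem_insert_iff, Set.mem_singleton_iff, true_iff]
    by_cases hx : x = a
    · exact Or.inl hx
    · exact Or.inr (hcon x hx)
  have h2 : ({a, b} : Set V).ncard ≤ 2 := (Set.ncard_insert_le a {b}).trans (by simp)
  rw [← this, Set.ncard_univ] at h2
  omega

lemma exists_out [Fintype V] (T : Tournament V) (hP : T.PrimeOn Set.univ) (h3 : 3 ≤ Nat.card V)
    (u : V) : ∃ w, T.rel u w := by
  by_contra hcon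
  push Not at hcon
  obtain ⟨a, ha, -⟩ := exists_third h3 u u
  obtain ⟨b, hb, hba⟩ := exists_third h3 u a
  have := T.prime_tool hP {x | x ≠ u} (a := a) (b := b) ha hb hba.symm (by
    intro v hv
    simp only [Set.mem_ofPred_eq, not_not] at hv
    subst hv
    exact Or.inr fun x hx => T.rel_of_not (Ne.symm hx) (hcon x))
  have hmem : u ∈ {x | x ≠ u} := by rw [this]; trivial
  exact hmem rfl

lemma exists_in [Fintype V] (T : Tournament V) (hP : T.PrimeOn Set.univ) (h3 : 3 ≤ Nat.card V)
    (u : V) : ∃ w, T.rel w u := by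
  by_contra hcon
  push Not at hcon
  obtain ⟨a, ha, -⟩ := exists_third h3 u u
  obtain ⟨b, hb, hba⟩ := exists_third h3 u a
  have := T.prime_tool hP {x | x ≠ u} (a := a) (b := b) ha hb hba.symm (by
    intro v hv
    simp only [Set.mem_ofPred_eq, not_not] at hv
    subst hv
    exact Or.inl fun x hx => T.rel_of_not hx (hcon x))
  have hmem : u ∈ {x | x ≠ u} := by rw [this]; trivial
  exact hmem rfl

/-- No cyclic triangle in an out-neighbourhood. -/
lemma hout_of (T : Tournament V) (hD : ¬ T.HasSub DDrel) (v a b c : V)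
    (va : T.rel v a) (vb : T.rel v b) (vc : T.rel v c)
    (ab : T.rel a b) (bc : T.rel b c) (ca : T.rel c a) : False := by
  apply hD
  have n1 := T.ne_of_rel va
  have n2 := T.ne_of_rel vb
  have n3 := T.ne_of_rel vc
  have n4 := T.ne_of_rel ab
  have n5 := T.ne_of_rel bc
  have n6 := T.ne_of_rel ca
  have a1 := T.asymm _ _ va
  have a2 := T.asymm _ _ vb
  have a3 := T.asymm _ _ vc
  have a4 := T.asymm _ _ ab
  have a5 := T.asymm _ _ bc
  have a6 := T.asymm _ _ ca
  have i1 := T.irrefl_self v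
  have i2 := T.irrefl_self a
  have i3 := T.irrefl_self b
  have i4 := T.irrefl_self c
  refine ⟨![v, a, b, c], ?_, ?_⟩
  · intro i j hij
    fin_cases i <;> fin_cases j <;> simp_all
  · intro i j
    fin_cases i <;> fin_cases j <;> simp [DDrel, *]

/-- No cyclic triangle in an in-neighbourhood. -/
lemma hin_of [Fintype V] (T : Tournament V) (hP : T.PrimeOn Set.univ)
    (hD : ¬ T.HasSub DDrel) (v a b c : V)
    (av : T.rel a v) (bv : T.rel b v) (cv : T.rel c v)
    (ab : T.rel a b) (bc : T.rel b c) (ca : T.rel c a) : False := by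
  have hout := T.hout_of hD
  have key : {y | ¬ (T.rel a y ∧ T.rel b y ∧ T.rel c y)} = Set.univ := by
    refine T.prime_tool hP _ (a := a) (b := b) ?_ ?_ (T.ne_of_rel ab) ?_
    · exact fun h => T.irrefl_self _ h.1
    · exact fun h => T.irrefl_self _ h.2.1
    · intro x hx
      simp only [Set.mem_ofPred_eq, not_not] at hx
      obtain ⟨ax, bx, cx⟩ := hx
      right
      intro w hw
      simp only [Set.mem_ofPred_eq] at hw
      by_contra hwx
      have hne : w ≠ x := by rintro rfl; exact hw ⟨ax, bx, cx⟩
      have xw := T.rel_of_not hne hwx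
      have wa : w ≠ a := by rintro rfl; exact hwx ax
      have wb : w ≠ b := by rintro rfl; exact hwx bx
      have wc : w ≠ c := by rintro rfl; exact hwx cx
      have ta := T.total w a wa
      have tb := T.total w b wb
      have tc := T.total w c wc
      -- p → q, p → w, w → q gives p ⇒ q → x → w → q
      have sw : ∀ p q, T.rel p q → T.rel p x → T.rel q x → T.rel p w → T.rel w q → False :=
        fun p q pq px qx pw wq => hout p q x w pq px pw qx xw wq
      have s1 := sw a b ab ax bx
      have s2 := sw b c bc bx cx
      have s3 := sw c a ca cx ax
      have s4 := hout w a b c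
      tauto
  have hmem : v ∈ {y | ¬ (T.rel a y ∧ T.rel b y ∧ T.rel c y)} := by rw [key]; trivial
  exact hmem ⟨av, bv, cv⟩

lemma exists_succ [Fintype V] (T : Tournament V) (hP : T.PrimeOn Set.univ)
    (h3 : 3 ≤ Nat.card V) (hD : ¬ T.HasSub DDrel) (u : V) :
    ∃ m, T.rel u m ∧ ∀ x, T.rel u x → x ≠ m → T.rel m x := by
  have hout := T.hout_of hD
  let r : {w // T.rel u w} → {w // T.rel u w} → Prop := fun x y => T.rel x.1 y.1
  have : IsTrans _ r := ⟨by
    rintro ⟨x, hx⟩ ⟨y, hy⟩ ⟨z, hz⟩ (xy : T.rel x y) (yz : T.rel y z)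
    change T.rel x z
    by_contra hn
    have hne : x ≠ z := by rintro rfl; exact T.asymm _ _ xy yz
    exact hout u x y z hx hy hz xy yz (T.rel_of_not hne hn)⟩
  have : Std.Irrefl r := ⟨fun x => T.irrefl_self x.1⟩
  have wf : WellFounded r := Finite.wellFounded_of_trans_of_irrefl r
  obtain ⟨w, hw⟩ := T.exists_out hP h3 u
  obtain ⟨m, -, hm⟩ := wf.has_min Set.univ ⟨⟨w, hw⟩, trivial⟩
  refine ⟨m.1, m.2, fun x hx hne => ?_⟩
  exact T.rel_of_not hne (hm ⟨x, hx⟩ trivial)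

/-- The antipodal vertex. -/
lemma exists_anti [Fintype V] (T : Tournament V) (hP : T.PrimeOn Set.univ)
    (h3 : 3 ≤ Nat.card V) (hD : ¬ T.HasSub DDrel) (u m : V) (um : T.rel u m)
    (hm : ∀ x, T.rel u x → x ≠ m → T.rel m x) :
    ∃ a, T.rel a u ∧ T.rel m a ∧ (∀ x, T.rel u x → x ≠ m → T.rel x a) ∧
      ∀ x, T.rel m x ↔ (T.rel u x ∧ x ≠ m) ∨ x = a := by
  have hout := T.hout_of hD
  have hin := T.hin_of hP hD
  have hA : ∀ w, T.rel w u → T.rel m w → ∀ x, T.rel u x → x ≠ m → T.rel x w := by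
    intro w wu mw x ux xm
    have hne : w ≠ x := by rintro rfl; exact T.asymm _ _ wu ux
    refine T.rel_of_not hne fun wx => ?_
    exact hin x u m w ux (hm x ux xm) wx um mw wu
  have hB : ∀ w, T.rel w u → T.rel m w → ∀ x, T.rel x u → T.rel x m → T.rel w x := by
    intro w wu mw x xu xm
    have hne : x ≠ w := by rintro rfl; exact T.asymm _ _ xm mw
    refine T.rel_of_not hne fun xw => ?_
    exact hout x u m w xu xm xw um mw wu
  have hex : ∃ a, T.rel a u ∧ T.rel m a := by
    by_contra hcon
    push Not at hcon
    have := T.prime_tool hP {u, m} (a := u) (b := m) (by simp) (by simp) (T.ne_of_rel um) (by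
      intro v hv
      simp only [Set.mem_insert_iff, Set.mem_singleton_iff, not_or] at hv
      simp only [Set.mem_insert_iff, Set.mem_singleton_iff, forall_eq_or_imp, forall_eq]
      rcases T.total v u hv.1 with h | h
      · exact Or.inl ⟨h, T.rel_of_not (Ne.symm hv.2) (hcon v h)⟩
      · exact Or.inr ⟨h, hm v h hv.2⟩)
    obtain ⟨c, hc⟩ := exists_third h3 u m
    have hmem : c ∈ ({u, m} : Set V) := by rw [this]; trivial
    simp only [Set.mem_insert_iff, Set.mem_singleton_iff] at hmem
    tauto
  obtain ⟨a, au, ma⟩ := hex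
  have huniq : ∀ w, T.rel w u → T.rel m w → w = a := by
    intro w wu mw
    by_contra hwa
    have := T.prime_tool hP {w | T.rel w u ∧ T.rel m w} (a := w) (b := a) ⟨wu, mw⟩ ⟨au, ma⟩ hwa (by
      intro x hx
      simp only [Set.mem_ofPred_eq, not_and] at hx
      by_cases hxu : x = u
      · subst hxu; exact Or.inr fun y hy => hy.1
      by_cases hxm : x = m
      · subst hxm; exact Or.inl fun y hy => hy.2
      rcases T.total x u hxu with h | h
      · exact Or.inr fun y hy => hB y hy.1 hy.2 x h (T.rel_of_not (Ne.symm hxm) (hx h))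
      · exact Or.inl fun y hy => hA y hy.1 hy.2 x h hxm)
    have hmem : u ∈ {w | T.rel w u ∧ T.rel m w} := by rw [this]; trivial
    exact T.irrefl_self _ hmem.1
  refine ⟨a, au, ma, hA a au ma, fun x => ⟨fun mx => ?_, ?_⟩⟩
  · by_cases hxu : x = u
    · subst hxu; exact absurd um (T.asymm _ _ mx)
    rcases T.total x u hxu with h | h
    · exact Or.inr (huniq x h mx)
    · exact Or.inl ⟨h, (T.ne_of_rel mx).symm⟩
  · rintro (⟨h, hne⟩ | rfl)
    · exact hm x h hne
    · exact ma

open Classical in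
lemma main_dir [Fintype V] (T : Tournament V) (hP : T.PrimeOn Set.univ)
    (h3 : 3 ≤ Nat.card V) (hD : ¬ T.HasSub DDrel) :
    ∃ n : ℕ, Odd n ∧ 3 ≤ n ∧ T.IsoOnFin Set.univ (TTrel n) := by
  choose s us hs using T.exists_succ hP h3 hD
  choose a au sa xa hN using fun u => T.exists_anti hP h3 hD u (s u) (us u) (hs u)
  let N : V → Finset V := fun u => Finset.univ.filter fun x => T.rel u x
  have memN : ∀ u x, x ∈ N u ↔ T.rel u x := by intro u x; simp [N]
  have hNs : ∀ u, N (s u) = insert (a u) ((N u).erase (s u)) := by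
    intro u; ext x
    rw [memN, hN, Finset.mem_insert, Finset.mem_erase, memN]; tauto
  have hcard : ∀ u, (N (s u)).card = (N u).card := by
    intro u
    rw [hNs, Finset.card_insert_of_notMem, Finset.card_erase_add_one]
    · rw [memN]; exact us u
    · rw [Finset.mem_erase, memN]
      exact fun h => T.asymm _ _ (au u) h.2
  have Q : ∀ j u, j < (N u).card → T.rel u (s^[j+1] u) ∧
      (∀ i, 1 ≤ i → i ≤ j → s^[j+1] u ≠ s^[i] u) ∧
      (∀ x, T.rel u x → (∀ i, 1 ≤ i → i ≤ j + 1 → x ≠ s^[i] u) → T.rel (s^[j+1] u) x) := by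
    intro j
    induction j with
    | zero =>
      intro u _
      refine ⟨us u, fun i h1 h2 => by omega, fun x hx h => hs u x hx (h 1 le_rfl le_rfl)⟩
    | succ j ih =>
      intro u hj
      obtain ⟨q1, q2, q3⟩ := ih (s u) (by rw [hcard]; omega)
      simp only [← Function.iterate_succ_apply] at q1 q2 q3
      have hy : ∃ y ∈ N u, y ∉ (Finset.Icc 1 (j+1)).image (fun i => s^[i] u) := by
        by_contra hcon
        push Not at hcon
        have h1 := Finset.card_le_card (show N u ⊆ _ from hcon)
        have h2 := Finset.card_image_le (s := Finset.Icc 1 (j+1)) (f := fun i => s^[i] u)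
        simp only [Nat.card_Icc] at h2
        omega
      obtain ⟨y, hyN, hy⟩ := hy
      rw [memN] at hyN
      have hyne : ∀ i, 1 ≤ i → i ≤ j + 1 → y ≠ s^[i] u := by
        intro i h1 h2 h
        exact hy (Finset.mem_image.2 ⟨i, Finset.mem_Icc.2 ⟨h1, h2⟩, h.symm⟩)
      have hys : y ≠ s u := hyne 1 le_rfl (by omega)
      have hna : s^[j+1+1] u ≠ a u := by
        intro h
        have hya := xa u y hyN hys
        have : T.rel (s^[j+1+1] u) y := by
          apply q3 y (hs u y hyN hys)
          intro i h1 h2 hmem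
          by_cases hi : i = j + 1
          · subst hi
            rw [hmem] at hya
            rw [h] at hya
            exact T.irrefl_self _ hya
          · exact hyne (i+1) (by omega) (by omega) hmem
        rw [h] at this
        exact T.asymm _ _ this hya
      rcases (hN u _).1 q1 with ⟨h1, h2⟩ | h1
      · refine ⟨h1, ?_, ?_⟩
        · intro i hi1 hi2
          by_cases hi : i = 1
          · subst hi; exact h2
          · obtain ⟨i, rfl⟩ : ∃ i₀, i = i₀ + 1 := ⟨i - 1, by omega⟩
            exact q2 i (by omega) (by omega)
        · intro x hx h
          exact q3 x (hs u x hx (h 1 le_rfl (by omega)))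
            fun i hi1 hi2 => h (i+1) (by omega) (by omega)
      · exact absurd h1 hna
  have hrel : ∀ u x, T.rel u x ↔ ∃ m, 1 ≤ m ∧ m ≤ (N u).card ∧ x = s^[m] u := by
    intro u x
    have hsub : (Finset.Icc 1 (N u).card).image (fun i => s^[i] u) ⊆ N u := by
      intro y hy
      obtain ⟨i, hi, rfl⟩ := Finset.mem_image.1 hy
      rw [Finset.mem_Icc] at hi
      obtain ⟨i, rfl⟩ : ∃ i₀, i = i₀ + 1 := ⟨i - 1, by omega⟩
      exact (memN _ _).2 (Q i u (by omega)).1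
    have hinj : Set.InjOn (fun i => s^[i] u) (Finset.Icc 1 (N u).card : Finset ℕ) := by
      have key : ∀ i j, 1 ≤ i → i < j → j ≤ (N u).card → s^[j] u ≠ s^[i] u := by
        intro i j h1 h2 h3
        obtain ⟨j, rfl⟩ : ∃ j₀, j = j₀ + 1 := ⟨j - 1, by omega⟩
        exact (Q j u (by omega)).2.1 i h1 (by omega)
      intro i hi j hj hij
      simp only [Finset.coe_Icc, Set.mem_Icc] at hi hj
      rcases lt_trichotomy i j with h | h | h
      · exact absurd hij.symm (key i j hi.1 h hj.2)
      · exact h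
      · exact absurd hij (key j i hj.1 h hi.2)
    have heq := Finset.eq_of_subset_of_card_le hsub (by
      rw [Finset.card_image_of_injOn hinj]; simp)
    rw [← memN, ← heq, Finset.mem_image]
    constructor
    · rintro ⟨i, hi, rfl⟩
      rw [Finset.mem_Icc] at hi
      rw [heq]
      exact ⟨i, hi.1, hi.2, rfl⟩
    · rintro ⟨i, h1, h2, rfl⟩
      rw [heq] at h2
      exact ⟨i, Finset.mem_Icc.2 ⟨h1, h2⟩, rfl⟩
  obtain ⟨v, -⟩ := hP.1
  have hconst : ∀ i, (N (s^[i] v)).card = (N v).card := by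
    intro i
    induction i with
    | zero => rfl
    | succ i ih => rw [Function.iterate_succ_apply', hcard, ih]
  set k := (N v).card with hk
  have hk1 : 1 ≤ k := Finset.card_pos.2 ⟨s v, (memN _ _).2 (us v)⟩
  have hsurj : (Set.range fun i => s^[i] v) = Set.univ := by
    refine T.prime_tool hP _ (a := v) (b := s v) ⟨0, rfl⟩ ⟨1, rfl⟩ (T.ne_of_rel (us v)) ?_
    intro x hx
    left
    rintro _ ⟨i, rfl⟩
    refine T.rel_of_not ?_ ?_
    · rintro rfl; exact hx ⟨i, rfl⟩
    · intro h
      obtain ⟨m, -, -, rfl⟩ := (hrel _ _).1 h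
      exact hx ⟨m + i, Function.iterate_add_apply _ _ _ _⟩
  have hper : v ∈ Function.periodicPts s := by
    obtain ⟨y, hy⟩ := T.exists_in hP h3 v
    obtain ⟨i, rfl⟩ : y ∈ Set.range fun i => s^[i] v := by rw [hsurj]; trivial
    obtain ⟨m, h1, -, h2⟩ := (hrel _ _).1 hy
    refine ⟨m + i, by omega, ?_⟩
    change s^[m+i] v = v
    rw [Function.iterate_add_apply]; exact h2.symm
  set n := Function.minimalPeriod s v with hn
  have hnpos : 0 < n := Function.minimalPeriod_pos_of_mem_periodicPts hper
  have hiter : ∀ i j, s^[i] v = s^[j] v ↔ i % n = j % n := by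
    intro i j
    rw [← Function.iterate_mod_minimalPeriod_eq (n := i), ← Function.iterate_mod_minimalPeriod_eq (n := j)]
    exact Function.iterate_eq_iterate_iff_of_lt_minimalPeriod (Nat.mod_lt _ hnpos)
      (Nat.mod_lt _ hnpos)
  have hrel2 : ∀ i j, T.rel (s^[i] v) (s^[j] v) ↔ ∃ m, 1 ≤ m ∧ m ≤ k ∧ j % n = (m + i) % n := by
    intro i j
    rw [hrel, hconst]
    simp only [← Function.iterate_add_apply, hiter]
  let f : Fin n → V := fun i => s^[i.1] v
  have finj : Function.Injective f := by
    intro i j hij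
    have := (hiter _ _).1 hij
    rw [Nat.mod_eq_of_lt i.2, Nat.mod_eq_of_lt j.2] at this
    exact Fin.ext this
  have fsurj : Function.Surjective f := by
    intro x
    obtain ⟨i, rfl⟩ : x ∈ Set.range fun i => s^[i] v := by rw [hsurj]; trivial
    exact ⟨⟨i % n, Nat.mod_lt _ hnpos⟩, (hiter _ _).2 (Nat.mod_mod _ _)⟩
  have hncard : n = Nat.card V := by
    have := Nat.card_congr (Equiv.ofBijective f ⟨finj, fsurj⟩)
    simpa using this
  have hkn : k < n := by
    by_contra hcon
    have : T.rel (s^[0] v) (s^[0] v) := (hrel2 0 0).2 ⟨n, hnpos, by omega, by simp⟩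
    exact T.irrefl_self _ this
  have f1 : 2 * k < n := by
    by_contra hcon
    have r1 : T.rel (s^[0] v) (s^[k] v) := (hrel2 0 k).2 ⟨k, hk1, le_rfl, by simp⟩
    have r2 : T.rel (s^[k] v) (s^[0] v) := (hrel2 k 0).2 ⟨n - k, by omega, by omega, by
      rw [Nat.sub_add_cancel hkn.le]; simp⟩
    exact T.asymm _ _ r1 r2
  have f2 : n ≤ 2 * k + 1 := by
    by_contra hcon
    have hne : s^[0] v ≠ s^[k+1] v := by
      intro h
      have := (hiter _ _).1 h
      rw [Nat.mod_eq_of_lt hnpos, Nat.mod_eq_of_lt (by omega)] at this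
      omega
    rcases T.total _ _ hne with h | h
    · obtain ⟨m, h1, h2, h3⟩ := (hrel2 _ _).1 h
      rw [Nat.mod_eq_of_lt (by omega), Nat.mod_eq_of_lt (by omega)] at h3
      omega
    · obtain ⟨m, h1, h2, h3⟩ := (hrel2 _ _).1 h
      rw [Nat.mod_eq_of_lt (by omega), Nat.mod_eq_of_lt (by omega)] at h3
      omega
  have hnk : n = 2 * k + 1 := by omega
  refine ⟨n, ⟨k, hnk⟩, by omega, f, finj, fsurj.range_eq, ?_⟩
  intro i j
  have hi := i.2
  have hj := j.2
  rw [hrel2]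
  unfold TTrel
  have hk2 : n / 2 = k := by omega
  rw [hk2]
  constructor
  · rintro ⟨h1, h2⟩
    refine ⟨_, h1, h2, ?_⟩
    rw [Nat.mod_add_mod, show j.1 + n - i.1 + i.1 = j.1 + n by omega, Nat.add_mod_right]
  · rintro ⟨m, h1, h2, h3⟩
    have : (j.1 + n - i.1) % n = m := by
      rw [Nat.mod_eq_of_lt hj] at h3
      by_cases hlt : m + i.1 < n
      · rw [Nat.mod_eq_of_lt hlt] at h3
        rw [h3, show m + i.1 + n - i.1 = m + n by omega, Nat.add_mod_right,
          Nat.mod_eq_of_lt (by omega)]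
      · rw [Nat.mod_eq_sub_mod (by omega), Nat.mod_eq_of_lt (by omega)] at h3
        rw [h3, show m + i.1 - n + n - i.1 = m by omega, Nat.mod_eq_of_lt (by omega)]
    rw [this]; exact ⟨h1, h2⟩

end Tournament

lemma TTrel_iff {n : ℕ} (i j : Fin n) : TTrel n i j ↔
    (i.1 < j.1 ∧ j.1 - i.1 ≤ n / 2) ∨ (j.1 < i.1 ∧ j.1 + n - i.1 ≤ n / 2) := by
  have hi := i.2
  have hj := j.2
  unfold TTrel
  by_cases h : i.1 ≤ j.1
  · rw [show j.1 + n - i.1 = (j.1 - i.1) + n by omega, Nat.add_mod_right,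
      Nat.mod_eq_of_lt (by omega)]
    omega
  · rw [Nat.mod_eq_of_lt (by omega)]
    omega

lemma TT_noD {n : ℕ} (hn : Odd n) (v a b c : Fin n) (va : TTrel n v a) (vb : TTrel n v b)
    (vc : TTrel n v c) (ab : TTrel n a b) (bc : TTrel n b c) (ca : TTrel n c a) : False := by
  obtain ⟨k, hk⟩ := hn
  rw [TTrel_iff] at *
  have h1 := v.2
  have h2 := a.2
  have h3 := b.2
  have h4 := c.2
  have hk2 : n / 2 = k := by omega
  rw [hk2] at *
  omega

/-- A prime tournament with at least 3 vertices has no subtournament isomorphic to `D_4`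
if and only if it is isomorphic to `T_n` for some odd `n ≥ 3`. -/
theorem stmt6 {V : Type} [Fintype V] (T : Tournament V)
    (hP : T.PrimeOn Set.univ) (h3 : 3 ≤ Nat.card V) :
    ¬ T.HasSub DDrel ↔ ∃ n : ℕ, Odd n ∧ 3 ≤ n ∧ T.IsoOnFin Set.univ (TTrel n) := by
  constructor
  · exact T.main_dir hP h3
  · rintro ⟨n, hn, -, f, -, hr, hf⟩ ⟨g, -, hg⟩
    have hpre : ∀ x, ∃ i, f i = x := fun x => by
      have : x ∈ Set.range f := by rw [hr]; trivial
      exact this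
    choose e he using hpre
    have key : ∀ i j, DDrel i j → TTrel n (e (g i)) (e (g j)) := by
      intro i j h
      rw [hf, he, he]
      exact (hg i j).1 h
    exact TT_noD hn _ _ _ _ (key 0 1 (by simp [DDrel])) (key 0 2 (by simp [DDrel]))
      (key 0 3 (by simp [DDrel])) (key 1 2 (by simp [DDrel])) (key 2 3 (by simp [DDrel]))
      (key 3 1 (by simp [DDrel]))
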